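/- Consistency of CD: there is no closed proof term t with CD ⊢ t : ⊥. -/

import Mathlib

/-! A Curry-Howard formalization of the intuitionistic first-order logic of
constant domains CD (Aschieri-Genco style), with de Bruijn indices both for
first-order variables and for proof-term variables. -/

/-- First-order terms: variables (de Bruijn), constants, function applications. -/
inductive Tm : Type where
  | var : ℕ → Tm
  | const : ℕ → Tm
  | func : ℕ → List Tm → Tm

namespace Tm

/-- Lift (shift by `d`) the first-order variables `≥ c`. -/
def lift (d c : ℕ) : Tm → Tm
  | var i => if i < c then var i else var (i + d)
  | const k => const k
  | func f ts => func f (ts.attach.map fun x => lift d c x.1)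
termination_by t => sizeOf t
decreasing_by have := List.sizeOf_lt_of_mem x.2; simp; omega

/-- Substitute the term `m` for the first-order variable `k` (variables `> k` are decremented). -/
def subst (k : ℕ) (m : Tm) : Tm → Tm
  | var i => if i = k then m else if i < k then var i else var (i - 1)
  | const c' => const c'
  | func f ts => func f (ts.attach.map fun x => subst k m x.1)
termination_by t => sizeOf t
decreasing_by have := List.sizeOf_lt_of_mem x.2; simp; omega

end Tm

/-- First-order formulas, with de Bruijn quantifiers. -/
inductive Fml : Type where
  | atom : ℕ → List Tm → Fml
  | bot : Fml
  | conj : Fml → Fml → Fml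
  | disj : Fml → Fml → Fml
  | impl : Fml → Fml → Fml
  | all : Fml → Fml
  | ex : Fml → Fml

namespace Fml

/-- Lift (shift by `d`) the free first-order variables `≥ c`. -/
def lift (d : ℕ) : ℕ → Fml → Fml
  | c, atom P ts => atom P (ts.map (Tm.lift d c))
  | _, bot => bot
  | c, conj A B => conj (lift d c A) (lift d c B)
  | c, disj A B => disj (lift d c A) (lift d c B)
  | c, impl A B => impl (lift d c A) (lift d c B)
  | c, all A => all (lift d (c + 1) A)
  | c, ex A => ex (lift d (c + 1) A)

/-- Substitute the term `m` for the free first-order variable `k`. -/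
def subst : ℕ → Tm → Fml → Fml
  | k, m, atom P ts => atom P (ts.map (Tm.subst k m))
  | _, _, bot => bot
  | k, m, conj A B => conj (subst k m A) (subst k m B)
  | k, m, disj A B => disj (subst k m A) (subst k m B)
  | k, m, impl A B => impl (subst k m A) (subst k m B)
  | k, m, all A => all (subst (k + 1) (m.lift 1 0) A)
  | k, m, ex A => ex (subst (k + 1) (m.lift 1 0) A)

/-- Atomic formulas (including `⊥`, a 0-ary predicate symbol). -/
def Atomic : Fml → Prop
  | atom _ _ => True
  | bot => True
  | _ => False

end Fml

/-- Proof terms of CD. Proof-term variables are de Bruijn indices; `lam`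
binds a proof variable, `qlam` binds a first-order variable, `case` binds one
proof variable in each branch, `edest` binds one first-order variable and one
proof variable in its second argument. `D A B` is the constant for the
constant-domain axiom `∀α(A ∨ B) → ∀α A ∨ B` (in de Bruijn style, `A` may
contain the bound variable `0` while `B` is a formula of the outer context,
so that "`α` does not occur in `B`" holds by construction). -/
inductive Pf : Type where
  | var : ℕ → Pf
  | pair : Pf → Pf → Pf
  | proj : Bool → Pf → Pf
  | lam : Fml → Pf → Pf
  | app : Pf → Pf → Pf
  | inj : Bool → Pf → Pf
  | case : Pf → Pf → Pf → Pf
  | qlam : Pf → Pf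
  | qapp : Pf → Tm → Pf
  | epair : Tm → Pf → Pf
  | edest : Pf → Pf → Pf
  | efq : Fml → Pf → Pf
  | D : Fml → Fml → Pf

namespace Pf

/-- Lift the free first-order variables `≥ c` by `d` in a proof term. -/
def tlift : Pf → ℕ → ℕ → Pf
  | var n, _, _ => var n
  | pair u t, d, c => pair (tlift u d c) (tlift t d c)
  | proj b u, d, c => proj b (tlift u d c)
  | lam A u, d, c => lam (A.lift d c) (tlift u d c)
  | app u t, d, c => app (tlift u d c) (tlift t d c)
  | inj b u, d, c => inj b (tlift u d c)
  | case u w₁ w₂, d, c => case (tlift u d c) (tlift w₁ d c) (tlift w₂ d c)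
  | qlam u, d, c => qlam (tlift u d (c + 1))
  | qapp u m, d, c => qapp (tlift u d c) (m.lift d c)
  | epair m u, d, c => epair (m.lift d c) (tlift u d c)
  | edest u v, d, c => edest (tlift u d c) (tlift v d (c + 1))
  | efq P u, d, c => efq (P.lift d c) (tlift u d c)
  | D A B, d, c => D (A.lift d (c + 1)) (B.lift d c)

/-- Lift the free proof-term variables `≥ c` by `d` in a proof term. -/
def plift : Pf → ℕ → ℕ → Pf
  | var n, d, c => if n < c then var n else var (n + d)
  | pair u t, d, c => pair (plift u d c) (plift t d c)
  | proj b u, d, c => proj b (plift u d c)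
  | lam A u, d, c => lam A (plift u d (c + 1))
  | app u t, d, c => app (plift u d c) (plift t d c)
  | inj b u, d, c => inj b (plift u d c)
  | case u w₁ w₂, d, c => case (plift u d c) (plift w₁ d (c + 1)) (plift w₂ d (c + 1))
  | qlam u, d, c => qlam (plift u d c)
  | qapp u m, d, c => qapp (plift u d c) m
  | epair m u, d, c => epair m (plift u d c)
  | edest u v, d, c => edest (plift u d c) (plift v d (c + 1))
  | efq P u, d, c => efq P (plift u d c)
  | D A B, _, _ => D A B

/-- Substitute the proof term `q` for the proof variable `k` (variables `> k` decremented). -/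
def psubst : Pf → ℕ → Pf → Pf
  | var n, k, q => if n = k then q else if n < k then var n else var (n - 1)
  | pair u t, k, q => pair (psubst u k q) (psubst t k q)
  | proj b u, k, q => proj b (psubst u k q)
  | lam A u, k, q => lam A (psubst u (k + 1) (plift q 1 0))
  | app u t, k, q => app (psubst u k q) (psubst t k q)
  | inj b u, k, q => inj b (psubst u k q)
  | case u w₁ w₂, k, q =>
      case (psubst u k q) (psubst w₁ (k + 1) (plift q 1 0)) (psubst w₂ (k + 1) (plift q 1 0))
  | qlam u, k, q => qlam (psubst u k (tlift q 1 0))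
  | qapp u m, k, q => qapp (psubst u k q) m
  | epair m u, k, q => epair m (psubst u k q)
  | edest u v, k, q => edest (psubst u k q) (psubst v (k + 1) (tlift (plift q 1 0) 1 0))
  | efq P u, k, q => efq P (psubst u k q)
  | D A B, _, _ => D A B

/-- Substitute the first-order term `m` for the first-order variable `k` in a proof term. -/
def tsubst : Pf → ℕ → Tm → Pf
  | var n, _, _ => var n
  | pair u t, k, m => pair (tsubst u k m) (tsubst t k m)
  | proj b u, k, m => proj b (tsubst u k m)
  | lam A u, k, m => lam (A.subst k m) (tsubst u k m)
  | app u t, k, m => app (tsubst u k m) (tsubst t k m)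
  | inj b u, k, m => inj b (tsubst u k m)
  | case u w₁ w₂, k, m => case (tsubst u k m) (tsubst w₁ k m) (tsubst w₂ k m)
  | qlam u, k, m => qlam (tsubst u (k + 1) (m.lift 1 0))
  | qapp u t, k, m => qapp (tsubst u k m) (Tm.subst k m t)
  | epair t u, k, m => epair (Tm.subst k m t) (tsubst u k m)
  | edest u v, k, m => edest (tsubst u k m) (tsubst v (k + 1) (m.lift 1 0))
  | efq P u, k, m => efq (P.subst k m) (tsubst u k m)
  | D A B, k, m => D (A.subst (k + 1) (m.lift 1 0)) (B.subst k m)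

/-- The set of free proof-term variables of a proof term. -/
def fvars : Pf → Set ℕ
  | var n => {n}
  | pair u t => fvars u ∪ fvars t
  | proj _ u => fvars u
  | lam _ u => {n | n + 1 ∈ fvars u}
  | app u t => fvars u ∪ fvars t
  | inj _ u => fvars u
  | case u w₁ w₂ => fvars u ∪ {n | n + 1 ∈ fvars w₁} ∪ {n | n + 1 ∈ fvars w₂}
  | qlam u => fvars u
  | qapp u _ => fvars u
  | epair _ u => fvars u
  | edest u v => fvars u ∪ {n | n + 1 ∈ fvars v}
  | efq _ u => fvars u
  | D _ _ => ∅

end Pf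

/-- The typing relation of CD: `Typed Γ t A` means that the proof term `t`
proves `A` from the (proof-variable) context `Γ`.  In the rules `qlam` and
`edest`, the side condition "the generalized first-order variable does not
occur in the context (resp. in the context and the conclusion)" is rendered,
de Bruijn style, by lifting. -/
inductive Typed : List Fml → Pf → Fml → Prop where
  | var {Γ n A} : Γ[n]? = some A → Typed Γ (.var n) A
  | pair {Γ u t A B} : Typed Γ u A → Typed Γ t B → Typed Γ (.pair u t) (.conj A B)
  | projL {Γ u A B} : Typed Γ u (.conj A B) → Typed Γ (.proj false u) A
  | projR {Γ u A B} : Typed Γ u (.conj A B) → Typed Γ (.proj true u) B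
  | lam {Γ u A B} : Typed (A :: Γ) u B → Typed Γ (.lam A u) (.impl A B)
  | app {Γ t u A B} : Typed Γ t (.impl A B) → Typed Γ u A → Typed Γ (.app t u) B
  | injL {Γ u A B} : Typed Γ u A → Typed Γ (.inj false u) (.disj A B)
  | injR {Γ u A B} : Typed Γ u B → Typed Γ (.inj true u) (.disj A B)
  | case {Γ u w₁ w₂ A B C} : Typed Γ u (.disj A B) → Typed (A :: Γ) w₁ C →
      Typed (B :: Γ) w₂ C → Typed Γ (.case u w₁ w₂) C
  | qlam {Γ u A} : Typed (Γ.map (Fml.lift 1 0)) u A → Typed Γ (.qlam u) (.all A)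
  | qapp {Γ u A} (m : Tm) : Typed Γ u (.all A) → Typed Γ (.qapp u m) (A.subst 0 m)
  | epair {Γ u A} (m : Tm) : Typed Γ u (A.subst 0 m) → Typed Γ (.epair m u) (.ex A)
  | edest {Γ u t A C} : Typed Γ u (.ex A) →
      Typed (A :: Γ.map (Fml.lift 1 0)) t (C.lift 1 0) → Typed Γ (.edest u t) C
  | efq {Γ u P} : Typed Γ u .bot → Fml.Atomic P → Typed Γ (.efq P u) P
  | D {Γ A B} : Typed Γ (.D A B)
      (.impl (.all (.disj A (B.lift 1 0))) (.disj (.all A) B))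

/-- The one-step reduction relation of CD: the standard intuitionistic
reductions, the two reductions for the constant-domain axiom constant `D`
(where the fixed constant `c` of the language is `Tm.const 0`), and closure
under every term context. -/
inductive Step : Pf → Pf → Prop where
  -- intuitionistic redexes
  | beta {A u t} : Step (.app (.lam A u) t) (u.psubst 0 t)
  | qbeta {u m} : Step (.qapp (.qlam u) m) (u.tsubst 0 m)
  | projPair {u₀ u₁ b} : Step (.proj b (.pair u₀ u₁)) (if b then u₁ else u₀)
  | caseInj {b u w₁ w₂} : Step (.case (.inj b u) w₁ w₂) ((if b then w₂ else w₁).psubst 0 u)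
  | edestPair {m u v} : Step (.edest (.epair m u) v) ((v.tsubst 0 m).psubst 0 u)
  -- redexes for the constant-domain axiom
  | DinjL {A B u} : Step (.app (.D A B) (.qlam (.inj false u))) (.inj false (.qlam u))
  | DinjR {A B u} : Step (.app (.D A B) (.qlam (.inj true u))) (.inj true (u.tsubst 0 (.const 0)))
  -- congruence closure
  | pairL {u u' t} : Step u u' → Step (.pair u t) (.pair u' t)
  | pairR {u t t'} : Step t t' → Step (.pair u t) (.pair u t')
  | projC {b u u'} : Step u u' → Step (.proj b u) (.proj b u')
  | lamC {A u u'} : Step u u' → Step (.lam A u) (.lam A u')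
  | appL {u u' t} : Step u u' → Step (.app u t) (.app u' t)
  | appR {u t t'} : Step t t' → Step (.app u t) (.app u t')
  | injC {b u u'} : Step u u' → Step (.inj b u) (.inj b u')
  | caseU {u u' w₁ w₂} : Step u u' → Step (.case u w₁ w₂) (.case u' w₁ w₂)
  | caseL {u w₁ w₁' w₂} : Step w₁ w₁' → Step (.case u w₁ w₂) (.case u w₁' w₂)
  | caseR {u w₁ w₂ w₂'} : Step w₂ w₂' → Step (.case u w₁ w₂) (.case u w₁ w₂')
  | qlamC {u u'} : Step u u' → Step (.qlam u) (.qlam u')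
  | qappC {u u' m} : Step u u' → Step (.qapp u m) (.qapp u' m)
  | epairC {m u u'} : Step u u' → Step (.epair m u) (.epair m u')
  | edestL {u u' v} : Step u u' → Step (.edest u v) (.edest u' v)
  | edestR {u v v'} : Step v v' → Step (.edest u v) (.edest u v')
  | efqC {P u u'} : Step u u' → Step (.efq P u) (.efq P u')

/-- A proof term is normal if no reduction applies to it. -/
def NormalForm (t : Pf) : Prop := ∀ u, ¬ Step t u

namespace Fml

/-- Truth of a formula in the one-element structure in which every atom `P(ts)` holds. Terms are
irrelevant there, and quantifiers are vacuous. -/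
def TrivialTruth : Fml → Prop
  | atom _ _ => True
  | bot => False
  | conj A B => TrivialTruth A ∧ TrivialTruth B
  | disj A B => TrivialTruth A ∨ TrivialTruth B
  | impl A B => TrivialTruth A → TrivialTruth B
  | all A => TrivialTruth A
  | ex A => TrivialTruth A

theorem trivialTruth_lift (d c : ℕ) (A : Fml) :
    (A.lift d c).TrivialTruth ↔ A.TrivialTruth := by
  induction A generalizing c <;> simp_all [lift, TrivialTruth]

theorem trivialTruth_subst (k : ℕ) (m : Tm) (A : Fml) :
    (A.subst k m).TrivialTruth ↔ A.TrivialTruth := by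
  induction A generalizing k m <;> simp_all [subst, TrivialTruth]

end Fml

/-- CD is sound for the one-element structure. -/
theorem Typed.trivialTruth {Γ : List Fml} {t : Pf} {A : Fml} (h : Typed Γ t A)
    (hΓ : ∀ B ∈ Γ, B.TrivialTruth) : A.TrivialTruth := by
  induction h with
  | var h => exact hΓ _ (List.mem_of_getElem? h)
  | efq _ _ ih => exact (ih hΓ).elim
  | case _ _ _ ih ih₁ ih₂ =>
    rcases ih hΓ with h | h
    · exact ih₁ (by simpa using ⟨h, hΓ⟩)
    · exact ih₂ (by simpa using ⟨h, hΓ⟩)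
  | _ => simp_all [Fml.TrivialTruth, Fml.trivialTruth_lift, Fml.trivialTruth_subst]

/-- **Consistency of CD**: there is no closed proof term `t` with
`CD ⊢ t : ⊥`. -/
theorem consistency : ¬ ∃ t : Pf, Typed [] t .bot := by
  rintro ⟨t, h⟩
  exact h.trivialTruth (by simp)
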